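/- arXiv:1406.2510 — 2 statements merged into one kernel-verified Lean document; each statement's English description precedes it below -/
import Mathlib

section
/- Let S be a skew lattice with D-classes A > B, and let x, x' ∈ B and y, y' ∈ A. Then the intersection (x∧A) ∩ (A∧x') is nonempty if and only if A∧x∧A = A∧x'∧A, and when nonempty it equals the singleton {x∧x'}. Dually, (y∨B) ∩ (B∨y') is nonempty if and only if B∨y∨B = B∨y'∨B, and when nonempty it equals {y∨y'}. -/
/-- A skew lattice: a set with two idempotent associative operations
satisfying the absorption laws. -/
class SkewLattice (S : Type*) where
  meet : S → S → S
  join : S → S → S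
  meet_assoc : ∀ x y z : S, meet (meet x y) z = meet x (meet y z)
  join_assoc : ∀ x y z : S, join (join x y) z = join x (join y z)
  meet_idem : ∀ x : S, meet x x = x
  join_idem : ∀ x : S, join x x = x
  absorb₁ : ∀ x y : S, meet x (join x y) = x
  absorb₂ : ∀ x y : S, meet (join y x) x = x
  absorb₃ : ∀ x y : S, join x (meet x y) = x
  absorb₄ : ∀ x y : S, join (meet y x) x = x

namespace SkewLattice

variable {S : Type*} [SkewLattice S]

local infixl:70 " ∧' " => SkewLattice.meet
local infixl:65 " ∨' " => SkewLattice.join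

/-- The flat preorder `≤_L`: `x ≤_L y` iff `x ∧ y = x`. -/
def leqL (x y : S) : Prop := x ∧' y = x

/-- The flat preorder `≤_R`: `x ≤_R y` iff `y ∧ x = x`. -/
def leqR (x y : S) : Prop := y ∧' x = x

/-- Green's relation `R`. -/
def relR (x y : S) : Prop := x ∧' y = y ∧ y ∧' x = x

/-- Green's relation `L`. -/
def relL (x y : S) : Prop := x ∧' y = x ∧ y ∧' x = y

/-- Green's relation `D`. -/
def relD (x y : S) : Prop := x ∧' y ∧' x = x ∧ y ∧' x ∧' y = y

/-- The natural preorder `⪯`. -/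
def preceq (x y : S) : Prop := x ∧' y ∧' x = x

/-- A `D`-class: an equivalence class of Green's relation `D`. -/
def IsDClass (A : Set S) : Prop := ∃ a : S, A = {x | relD x a}

/-- `A > B` for `D`-classes: `A` and `B` are `D`-classes with every element of `B`
strictly below every element of `A` in the natural preorder. -/
def classGT (A B : Set S) : Prop :=
  IsDClass A ∧ IsDClass B ∧ ∀ a ∈ A, ∀ b ∈ B, preceq b a ∧ ¬ preceq a b

/-- A skew diamond `{J > A, B > M}`: two incomparable `D`-classes `A`, `B`
together with the `D`-class `M` of `a ∧ b ∧ a` and the `D`-class `J` of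
`a ∨ b ∨ a` for some `a ∈ A`, `b ∈ B`. -/
def IsSkewDiamond (J A B M : Set S) : Prop :=
  IsDClass J ∧ IsDClass A ∧ IsDClass B ∧ IsDClass M ∧
  (∀ a ∈ A, ∀ b ∈ B, ¬ preceq a b ∧ ¬ preceq b a) ∧
  ∃ a ∈ A, ∃ b ∈ B, (a ∧' b ∧' a) ∈ M ∧ (a ∨' b ∨' a) ∈ J

theorem preceq_of_eq {x p z q : S} (h : x = p ∧' z ∧' q) : preceq x z := by
  have h1 : x ∧' (z ∧' q) = x := by
    rw [h]; simp only [meet_assoc]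
    have := meet_idem (z ∧' q)
    simp only [meet_assoc] at this
    rw [this]
  have h2 : (x ∧' z) ∧' x = x := by
    calc (x ∧' z) ∧' x = (x ∧' z) ∧' (x ∧' (z ∧' q)) := by rw [h1]
      _ = ((x ∧' z) ∧' (x ∧' z)) ∧' q := by simp only [meet_assoc]
      _ = x := by rw [meet_idem, meet_assoc, h1]
  exact h2

theorem preceq_trans {x y z : S} (h1 : preceq x y) (h2 : preceq y z) : preceq x z := by
  apply preceq_of_eq (p := x ∧' y) (q := y ∧' x)
  unfold preceq at h1 h2
  calc x = x ∧' (y ∧' z ∧' y) ∧' x := by rw [h2, h1]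
    _ = _ := by simp only [meet_assoc]

/-- The dual skew lattice. -/
abbrev dualSL (S : Type*) [SkewLattice S] : SkewLattice S where
  meet := SkewLattice.join
  join := SkewLattice.meet
  meet_assoc := join_assoc
  join_assoc := meet_assoc
  meet_idem := join_idem
  join_idem := meet_idem
  absorb₁ := absorb₃
  absorb₂ := absorb₄
  absorb₃ := absorb₁
  absorb₄ := absorb₂

theorem join_of_preceq {x y : S} (h : x ∧' y ∧' x = x) : y ∨' x ∨' y = y := by
  have h1 : y ∨' (y ∧' x) = y := absorb₃ _ _
  have h2 : x ∨' (y ∧' x) = y ∧' x := by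
    have := absorb₄ (y ∧' x) x
    rwa [← meet_assoc, h] at this
  have h3 : y ∨' x ∨' (y ∧' x) = y := by rw [join_assoc, h2, h1]
  calc y ∨' x ∨' y = (y ∨' x) ∨' (y ∨' x ∨' (y ∧' x)) := by rw [h3]
    _ = ((y ∨' x) ∨' (y ∨' x)) ∨' (y ∧' x) := by simp only [join_assoc]
    _ = y := by rw [join_idem, h3]

theorem preceq_of_join {x y : S} (h : y ∨' x ∨' y = y) : x ∧' y ∧' x = x :=
  @join_of_preceq S (dualSL S) y x h

theorem core (A B : Set S) (cA : ∀ a ∈ A, ∀ b ∈ A, a ∧' b ∈ A)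
    (rA : ∀ a ∈ A, ∀ b ∈ A, a ∧' b ∧' a = a)
    (rB : ∀ a ∈ B, ∀ b ∈ B, a ∧' b ∧' a = a)
    (rBA : ∀ a ∈ A, ∀ b ∈ B, b ∧' a ∧' b = b)
    (j1 : ∀ a ∈ A, ∀ b ∈ B, a ∨' b ∈ A)
    (j2 : ∀ a ∈ A, ∀ b ∈ B, b ∨' a ∈ A)
    (cB : ∀ a ∈ A, ∀ b ∈ B, a ∧' b ∈ B)
    (cB' : ∀ a ∈ A, ∀ b ∈ B, b ∧' a ∈ B)
    (neA : A.Nonempty)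
    (x x' : S) (hx : x ∈ B) (hx' : x' ∈ B) :
    (({z : S | ∃ w ∈ A, z = x ∧' w} ∩ {z : S | ∃ w ∈ A, z = w ∧' x'}).Nonempty ↔
      {z : S | ∃ w ∈ A, z = w ∧' x ∧' w} = {z : S | ∃ w ∈ A, z = w ∧' x' ∧' w}) ∧
    (({z : S | ∃ w ∈ A, z = x ∧' w} ∩ {z : S | ∃ w ∈ A, z = w ∧' x'}).Nonempty →
      {z : S | ∃ w ∈ A, z = x ∧' w} ∩ {z : S | ∃ w ∈ A, z = w ∧' x'} = {x ∧' x'}) := by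
  obtain ⟨p, hp⟩ := neA
  have up : ∀ x ∈ B, ∃ c ∈ A, c ∧' x = x ∧ x ∧' c = x := fun x hx =>
    ⟨x ∨' (p ∨' x), j2 _ (j1 _ hp _ hx) _ hx,
      by rw [← join_assoc]; exact absorb₂ _ _, absorb₁ _ _⟩
  have invL : ∀ x ∈ B, ∀ w ∈ A, ∃ v ∈ A, v ∧' w ∧' x = x := by
    intro x hx w hw
    have hv := j1 w hw x hx
    refine ⟨w ∨' x, hv, ?_⟩
    have h1 := rA _ hv _ hw
    rw [meet_assoc, absorb₁] at h1
    rw [h1, absorb₂]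
  have invR : ∀ x ∈ B, ∀ w ∈ A, ∃ v ∈ A, x ∧' (w ∧' v) = x := by
    intro x hx w hw
    have hv := j2 w hw x hx
    refine ⟨x ∨' w, hv, ?_⟩
    have h1 := rA _ hv _ hw
    rw [absorb₂] at h1
    rw [h1, absorb₁]
  -- two-sided products are in the coset
  have two : ∀ x ∈ B, ∀ a ∈ A, ∀ b ∈ A, ∃ w ∈ A, a ∧' x ∧' b = w ∧' x ∧' w := by
    intro x hx a ha b hb
    obtain ⟨v, hv, h1⟩ := invL x hx a ha
    obtain ⟨u, hu, h2⟩ := invR x hx b hb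
    obtain ⟨c, hc, h3, h4⟩ := up (a ∧' x ∧' b) (cB' _ hb _ (cB _ ha _ hx))
    have hxz : v ∧' (a ∧' x ∧' b) ∧' u = x := by
      calc _ = (v ∧' a ∧' x) ∧' (b ∧' u) := by simp only [meet_assoc]
        _ = x := by rw [h1, h2]
    refine ⟨c, hc, ?_⟩
    generalize a ∧' x ∧' b = z at *
    symm
    calc c ∧' x ∧' c = c ∧' (v ∧' (c ∧' z ∧' c) ∧' u) ∧' c := by rw [h3, h4, hxz]
      _ = (c ∧' v ∧' c) ∧' z ∧' (c ∧' u ∧' c) := by simp only [meet_assoc]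
      _ = z := by rw [rA _ hc _ hv, rA _ hc _ hu, h3, h4]
  have sub : ∀ x ∈ B, ∀ a ∈ A, ∀ b ∈ A,
      {z : S | ∃ w ∈ A, z = w ∧' (a ∧' x ∧' b) ∧' w} = {z : S | ∃ w ∈ A, z = w ∧' x ∧' w} := by
    intro x hx a ha b hb
    ext t
    constructor
    · rintro ⟨w, hw, rfl⟩
      obtain ⟨c, hc, h⟩ := two x hx (w ∧' a) (cA _ hw _ ha) (b ∧' w) (cA _ hb _ hw)
      exact ⟨c, hc, by rw [← h]; simp only [meet_assoc]⟩
    · rintro ⟨w, hw, rfl⟩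
      obtain ⟨v, hv, h1⟩ := invL x hx a ha
      obtain ⟨u, hu, h2⟩ := invR x hx b hb
      have hxz : v ∧' (a ∧' x ∧' b) ∧' u = x := by
        calc _ = (v ∧' a ∧' x) ∧' (b ∧' u) := by simp only [meet_assoc]
          _ = x := by rw [h1, h2]
      obtain ⟨c, hc, h⟩ := two (a ∧' x ∧' b) (cB' _ hb _ (cB _ ha _ hx))
        (w ∧' v) (cA _ hw _ hv) (u ∧' w) (cA _ hu _ hw)
      refine ⟨c, hc, ?_⟩
      rw [← h]
      calc w ∧' x ∧' w = w ∧' (v ∧' (a ∧' x ∧' b) ∧' u) ∧' w := by rw [hxz]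
        _ = _ := by simp only [meet_assoc]
  have back : {z : S | ∃ w ∈ A, z = w ∧' x ∧' w} = {z : S | ∃ w ∈ A, z = w ∧' x' ∧' w} →
      x ∧' x' ∈ ({z : S | ∃ w ∈ A, z = x ∧' w} ∩ {z : S | ∃ w ∈ A, z = w ∧' x'}) := by
    intro h
    obtain ⟨c, hc, h1, h2⟩ := up x hx
    obtain ⟨d, hd, h3, h4⟩ := up x' hx'
    have e1 : x ∈ {z : S | ∃ w ∈ A, z = w ∧' x ∧' w} := ⟨c, hc, by rw [h1, h2]⟩
    have e2 : x' ∈ {z : S | ∃ w ∈ A, z = w ∧' x' ∧' w} := ⟨d, hd, by rw [h3, h4]⟩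
    rw [h] at e1
    rw [← h] at e2
    obtain ⟨a, ha, ea⟩ := e1
    obtain ⟨b, hb, eb⟩ := e2
    refine ⟨⟨b, hb, ?_⟩, ⟨a, ha, ?_⟩⟩
    · calc x ∧' x' = x ∧' (b ∧' x ∧' b) := by rw [← eb]
        _ = (x ∧' b ∧' x) ∧' b := by simp only [meet_assoc]
        _ = x ∧' b := by rw [rBA _ hb _ hx]
    · calc x ∧' x' = (a ∧' x' ∧' a) ∧' x' := by rw [← ea]
        _ = a ∧' (x' ∧' a ∧' x') := by simp only [meet_assoc]
        _ = a ∧' x' := by rw [rBA _ ha _ hx']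
  have fwd : ({z : S | ∃ w ∈ A, z = x ∧' w} ∩ {z : S | ∃ w ∈ A, z = w ∧' x'}).Nonempty →
      {z : S | ∃ w ∈ A, z = w ∧' x ∧' w} = {z : S | ∃ w ∈ A, z = w ∧' x' ∧' w} := by
    rintro ⟨z, ⟨w, hw, e1⟩, ⟨w', hw', e2⟩⟩
    obtain ⟨c, hc, h1, h2⟩ := up x hx
    obtain ⟨d, hd, h3, h4⟩ := up x' hx'
    rw [← sub x hx c hc w hw, ← sub x' hx' w' hw' d hd, h1, ← e1, meet_assoc, h4, ← e2]
  refine ⟨⟨fwd, fun h => ⟨_, back h⟩⟩, fun h => ?_⟩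
  apply Set.eq_singleton_iff_unique_mem.2
  refine ⟨back (fwd h), ?_⟩
  rintro z ⟨⟨w, hw, e1⟩, ⟨w', hw', e2⟩⟩
  have h1 : z ∧' x' = z := by rw [e2, meet_assoc, meet_idem]
  calc z = z ∧' (x' ∧' x ∧' x') := by rw [rB _ hx' _ hx, h1]
    _ = (z ∧' x') ∧' x ∧' x' := by simp only [meet_assoc]
    _ = (x ∧' w ∧' x) ∧' x' := by rw [h1, e1]
    _ = x ∧' x' := by rw [rBA _ hw _ hx]

/-- the intersection of a right coset and a left coset is nonempty
iff the corresponding full cosets coincide, in which case it is a singleton. -/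
theorem coset_intersection (A B : Set S) (hAB : classGT A B)
    (x x' : S) (hx : x ∈ B) (hx' : x' ∈ B)
    (y y' : S) (hy : y ∈ A) (hy' : y' ∈ A) :
    (({z : S | ∃ w ∈ A, z = x ∧' w} ∩ {z : S | ∃ w ∈ A, z = w ∧' x'}).Nonempty ↔
      {z : S | ∃ w ∈ A, z = w ∧' x ∧' w} = {z : S | ∃ w ∈ A, z = w ∧' x' ∧' w}) ∧
    (({z : S | ∃ w ∈ A, z = x ∧' w} ∩ {z : S | ∃ w ∈ A, z = w ∧' x'}).Nonempty →
      {z : S | ∃ w ∈ A, z = x ∧' w} ∩ {z : S | ∃ w ∈ A, z = w ∧' x'} = {x ∧' x'}) ∧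
    (({z : S | ∃ w ∈ B, z = y ∨' w} ∩ {z : S | ∃ w ∈ B, z = w ∨' y'}).Nonempty ↔
      {z : S | ∃ w ∈ B, z = w ∨' y ∨' w} = {z : S | ∃ w ∈ B, z = w ∨' y' ∨' w}) ∧
    (({z : S | ∃ w ∈ B, z = y ∨' w} ∩ {z : S | ∃ w ∈ B, z = w ∨' y'}).Nonempty →
      {z : S | ∃ w ∈ B, z = y ∨' w} ∩ {z : S | ∃ w ∈ B, z = w ∨' y'} = {y ∨' y'}) := by
  obtain ⟨⟨a0, rfl⟩, ⟨b0, rfl⟩, hlt⟩ := hAB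
  have rel : ∀ c : S, ∀ a ∈ {x | relD x c}, ∀ b ∈ {x | relD x c}, preceq a b :=
    fun c a ha b hb => preceq_trans ha.1 hb.2
  have mem : ∀ c : S, ∀ a ∈ {x | relD x c}, ∀ b, preceq a b → preceq b a →
      b ∈ {x | relD x c} :=
    fun c a ha b h1 h2 => ⟨preceq_trans h2 ha.1, preceq_trans ha.2 h1⟩
  have ba : ∀ a ∈ {x | relD x a0}, ∀ b ∈ {x | relD x b0}, preceq b a :=
    fun a ha b hb => (hlt a ha b hb).1
  -- if `a ⪯ b` then `a ∧ b`, `b ∧ a` are D-related to `a`; dually for joins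
  have m1 : ∀ c : S, ∀ a ∈ {x | relD x c}, ∀ b, preceq a b → a ∧' b ∈ {x | relD x c} := by
    intro c a ha b h
    apply mem c a ha
    · refine preceq_of_eq (p := a) (q := a) ?_
      unfold preceq at h
      rw [← meet_assoc, meet_idem, h]
    · refine preceq_of_eq (p := a) (q := b) ?_
      rw [meet_idem]
  have m2 : ∀ c : S, ∀ a ∈ {x | relD x c}, ∀ b, preceq a b → b ∧' a ∈ {x | relD x c} := by
    intro c a ha b h
    apply mem c a ha
    · refine preceq_of_eq (p := a) (q := a) ?_
      unfold preceq at h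
      rw [meet_assoc, meet_assoc, meet_idem, ← meet_assoc, h]
    · refine preceq_of_eq (p := b) (q := a) ?_
      rw [meet_assoc, meet_idem]
  have j1 : ∀ c : S, ∀ a ∈ {x | relD x c}, ∀ b, preceq b a → a ∨' b ∈ {x | relD x c} := by
    intro c a ha b h
    apply mem c a ha
    · show a ∧' (a ∨' b) ∧' a = a
      rw [absorb₁, meet_idem]
    · apply preceq_of_join
      rw [← join_assoc, join_idem]
      exact join_of_preceq h
  have j2 : ∀ c : S, ∀ a ∈ {x | relD x c}, ∀ b, preceq b a → b ∨' a ∈ {x | relD x c} := by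
    intro c a ha b h
    apply mem c a ha
    · show a ∧' (b ∨' a) ∧' a = a
      rw [meet_assoc, absorb₂, meet_idem]
    · apply preceq_of_join
      rw [join_assoc, join_assoc, join_idem, ← join_assoc]
      exact join_of_preceq h
  have P := core {x | relD x a0} {x | relD x b0}
    (fun a ha b hb => m1 _ a ha b (rel _ a ha b hb)) (rel a0) (rel b0) ba
    (fun a ha b hb => j1 _ a ha b (ba a ha b hb))
    (fun a ha b hb => j2 _ a ha b (ba a ha b hb))
    (fun a ha b hb => m2 _ b hb a (ba a ha b hb))
    (fun a ha b hb => m1 _ b hb a (ba a ha b hb)) ⟨y, hy⟩ x x' hx hx'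
  have Q := @core S (dualSL S) {x | relD x b0} {x | relD x a0}
    (fun a ha b hb => j1 _ a ha b (rel _ b hb a ha))
    (fun a ha b hb => join_of_preceq (rel _ b hb a ha))
    (fun a ha b hb => join_of_preceq (rel _ b hb a ha))
    (fun a ha b hb => join_of_preceq (ba b hb a ha))
    (fun a ha b hb => m1 _ a ha b (ba b hb a ha))
    (fun a ha b hb => m2 _ a ha b (ba b hb a ha))
    (fun a ha b hb => j2 _ b hb a (ba b hb a ha))
    (fun a ha b hb => j1 _ b hb a (ba b hb a ha)) ⟨x, hx⟩ y y' hy hy'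
  exact ⟨P.1, P.2, Q.1, Q.2⟩

end SkewLattice
end

section
/- Let S be a skew lattice. Then S is normal, i.e. satisfies the identity x∧y∧z∧w = x∧z∧y∧w, if and only if for every pair of D-classes A > B in S and all x, x' ∈ B the following two implications hold: (i) if x L x' then A∧x = A∧x'; (ii) if x R x' then x∧A = x'∧A. -/
namespace SkewLattice

variable {S : Type*} [SkewLattice S]

local infixl:70 " ∧' " => SkewLattice.meet
local infixl:65 " ∨' " => SkewLattice.join

theorem aux_F (x u z t : S) (h : x = u ∧' z ∧' t) : preceq x z := by
  have h1 : x ∧' (z ∧' t) = x := by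
    rw [h, meet_assoc u z t, meet_assoc u, meet_idem]
  have h2 : x ∧' z ∧' x ∧' z ∧' t = x := by
    rw [meet_assoc (x ∧' z) x z, meet_idem, meet_assoc, h1]
  unfold preceq
  calc x ∧' z ∧' x = x ∧' z ∧' (x ∧' (z ∧' t)) := by rw [h1]
    _ = x ∧' z ∧' x ∧' z ∧' t := by simp only [meet_assoc]
    _ = x := h2

theorem aux_trans {x y z : S} (h : preceq x y) (k : preceq y z) : preceq x z := by
  unfold preceq at h k
  apply aux_F x (x ∧' y) z (y ∧' x)
  calc x = x ∧' (y ∧' z ∧' y) ∧' x := by rw [k, h]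
    _ = _ := by simp only [meet_assoc]

theorem aux_mul {x y z : S} (h : preceq x y) (k : preceq x z) : preceq x (y ∧' z) := by
  unfold preceq at *
  calc x ∧' (y ∧' z) ∧' x = (x ∧' z ∧' x) ∧' (y ∧' z) ∧' (x ∧' y ∧' x) := by rw [h, k]
    _ = x ∧' ((z ∧' x ∧' y) ∧' (z ∧' x ∧' y)) ∧' x := by simp only [meet_assoc]
    _ = (x ∧' z ∧' x) ∧' y ∧' x := by rw [meet_idem]; simp only [meet_assoc]
    _ = x := by rw [k, h]

theorem aux_refl (x : S) : preceq x x := by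
  unfold preceq; rw [meet_idem, meet_idem]

/-- The coset law. -/
def CosetLaw (S : Type*) [SkewLattice S] : Prop :=
  ∀ A B : Set S, classGT A B → ∀ x ∈ B, ∀ x' ∈ B,
      (relL x x' → {z : S | ∃ w ∈ A, z = w ∧' x} = {z : S | ∃ w ∈ A, z = w ∧' x'}) ∧
      (relR x x' → {z : S | ∃ w ∈ A, z = x ∧' w} = {z : S | ∃ w ∈ A, z = x' ∧' w})

theorem aux_unique (H : CosetLaw S) (a b d : S) (hab : a ∧' b = b) (hba : b ∧' a = b)
    (had : a ∧' d = d) (hda : d ∧' a = d) (hbd : preceq b d) (hdb : preceq d b) : b = d := by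
  have pba : preceq b a := by unfold preceq; rw [hba, meet_idem]
  by_cases hx : preceq a b
  · have e1 : a = b := by
      have := hx
      unfold preceq at this
      rw [hab, hba] at this
      exact this.symm
    have hx' := aux_trans hx hbd
    have e2 : a = d := by
      unfold preceq at hx'
      rw [had, hda] at hx'
      exact hx'.symm
    rw [← e1, ← e2]
  · have hgt : classGT {x : S | relD x a} {x : S | relD x b} := by
      refine ⟨⟨a, rfl⟩, ⟨b, rfl⟩, ?_⟩
      rintro y ⟨hy1, hy2⟩ z ⟨hz1, hz2⟩
      refine ⟨aux_trans hz1 (aux_trans pba hy2), fun h => hx ?_⟩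
      exact aux_trans hy2 (aux_trans h hz1)
    have hcb : b ∧' d ∧' b = b := hbd
    have hdd : d ∧' b ∧' d = d := hdb
    have bB : b ∈ {x : S | relD x b} := ⟨aux_refl b, aux_refl b⟩
    have dB : d ∈ {x : S | relD x b} := ⟨hdb, hbd⟩
    have cB : b ∧' d ∈ {x : S | relD x b} := by
      refine ⟨?_, aux_mul (aux_refl b) hbd⟩
      rw [hcb, ← meet_assoc, meet_idem]
    have aA : a ∈ {x : S | relD x a} := ⟨aux_refl a, aux_refl a⟩
    have hac : a ∧' (b ∧' d) = b ∧' d := by rw [← meet_assoc, hab]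
    have hca : (b ∧' d) ∧' a = b ∧' d := by rw [meet_assoc, hda]
    have hL := (H _ _ hgt _ cB _ dB).1
      ⟨by rw [meet_assoc, meet_idem], by rw [← meet_assoc, hdd]⟩
    have hR := (H _ _ hgt _ bB _ cB).2
      ⟨by rw [← meet_assoc, meet_idem], hcb⟩
    have m1 : b ∧' d ∈ {z : S | ∃ w ∈ {x : S | relD x a}, z = w ∧' (b ∧' d)} :=
      ⟨a, aA, hac.symm⟩
    have m2 : b ∈ {z : S | ∃ w ∈ {x : S | relD x a}, z = b ∧' w} :=
      ⟨a, aA, hba.symm⟩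
    rw [hL] at m1
    rw [hR] at m2
    obtain ⟨v, hv, ev⟩ := m1
    obtain ⟨w, hw, ew⟩ := m2
    have e1 : b ∧' d = d := by
      calc b ∧' d = a ∧' (v ∧' d) := by rw [← ev, hac]
        _ = a ∧' (v ∧' (a ∧' d)) := by rw [had]
        _ = (a ∧' v ∧' a) ∧' d := by simp only [meet_assoc]
        _ = d := by rw [hv.2, had]
    have e2 : b = b ∧' d := by
      calc b = (b ∧' d ∧' w) ∧' a := by rw [← ew, hba]
        _ = (b ∧' d ∧' a ∧' w) ∧' a := by rw [hca]
        _ = (b ∧' d) ∧' (a ∧' w ∧' a) := by simp only [meet_assoc]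
        _ = b ∧' d := by rw [hw.2, hca]
    exact e2.trans e1

theorem aux_below (x y z : S) :
    preceq (x ∧' y ∧' z ∧' x) (x ∧' z ∧' y ∧' x) := by
  have hx : preceq (x ∧' y ∧' z ∧' x) x :=
    aux_F _ x x (y ∧' z ∧' x) (by rw [meet_idem]; simp only [meet_assoc])
  have hy : preceq (x ∧' y ∧' z ∧' x) y :=
    aux_F _ x y (z ∧' x) (by simp only [meet_assoc])
  have hz : preceq (x ∧' y ∧' z ∧' x) z := aux_F _ (x ∧' y) z x rfl
  exact aux_mul (aux_mul (aux_mul hx hz) hy) hx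

theorem aux_comm (H : CosetLaw S) (x y z : S) :
    x ∧' y ∧' z ∧' x = x ∧' z ∧' y ∧' x := by
  apply aux_unique H x _ _ _ _ _ _ (aux_below x y z) (aux_below x z y)
  · simp only [← meet_assoc, meet_idem]
  · rw [meet_assoc, meet_idem]
  · simp only [← meet_assoc, meet_idem]
  · rw [meet_assoc, meet_idem]

/-- a skew lattice is normal iff `L`-related elements of a lower
class determine the same left coset and `R`-related elements determine the
same right coset. -/
theorem normal_iff_coset_law :
    (∀ x y z w : S, x ∧' y ∧' z ∧' w = x ∧' z ∧' y ∧' w) ↔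
    (∀ A B : Set S, classGT A B → ∀ x ∈ B, ∀ x' ∈ B,
      (relL x x' → {z : S | ∃ w ∈ A, z = w ∧' x} = {z : S | ∃ w ∈ A, z = w ∧' x'}) ∧
      (relR x x' → {z : S | ∃ w ∈ A, z = x ∧' w} = {z : S | ∃ w ∈ A, z = x' ∧' w})) := by
  constructor
  · intro N A B _ x _ x' _
    constructor
    · rintro ⟨h1, h2⟩
      have key : ∀ w : S, w ∧' x = w ∧' x' := fun w => by
        calc w ∧' x = w ∧' (x ∧' x') := by rw [h1]
          _ = w ∧' x ∧' x' ∧' x' := by rw [meet_assoc _ x' x', meet_idem, meet_assoc]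
          _ = w ∧' x' ∧' x ∧' x' := N _ _ _ _
          _ = w ∧' x' := by rw [meet_assoc w x' x, h2, meet_assoc, meet_idem]
      simp only [key]
    · rintro ⟨h1, h2⟩
      have key : ∀ w : S, x ∧' w = x' ∧' w := fun w => by
        calc x ∧' w = x' ∧' x ∧' w := by rw [h2]
          _ = x' ∧' x' ∧' x ∧' w := by rw [meet_idem]
          _ = x' ∧' x ∧' x' ∧' w := N _ _ _ _
          _ = x' ∧' w := by rw [meet_assoc x' x x', h1, meet_idem]
      simp only [key]
  · intro H x y z w
    have C := aux_comm (S := S) H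
    have E0 : ∀ a b c d : S, preceq (a ∧' b ∧' c ∧' d ∧' a) (a ∧' c ∧' b ∧' d ∧' a) := by
      intro a b c d
      have ha : preceq (a ∧' b ∧' c ∧' d ∧' a) a :=
        aux_F _ a a (b ∧' c ∧' d ∧' a) (by rw [meet_idem]; simp only [meet_assoc])
      have hb : preceq (a ∧' b ∧' c ∧' d ∧' a) b :=
        aux_F _ a b (c ∧' d ∧' a) (by simp only [meet_assoc])
      have hc : preceq (a ∧' b ∧' c ∧' d ∧' a) c :=
        aux_F _ (a ∧' b) c (d ∧' a) (by simp only [meet_assoc])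
      have hd : preceq (a ∧' b ∧' c ∧' d ∧' a) d := aux_F _ (a ∧' b ∧' c) d a rfl
      exact aux_mul (aux_mul (aux_mul (aux_mul ha hc) hb) hd) ha
    have E : ∀ a b c d : S, a ∧' b ∧' c ∧' d ∧' a = a ∧' c ∧' b ∧' d ∧' a := by
      intro a b c d
      apply aux_unique H a _ _ _ _ _ _ (E0 a b c d) (E0 a c b d)
      · simp only [← meet_assoc, meet_idem]
      · rw [meet_assoc, meet_idem]
      · simp only [← meet_assoc, meet_idem]
      · rw [meet_assoc, meet_idem]
    have E1 := E x y z w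
    have E2 : w ∧' x ∧' y ∧' z ∧' w = w ∧' x ∧' z ∧' y ∧' w := by
      rw [meet_assoc w x y, C w (x ∧' y) z, ← meet_assoc (w ∧' z) x y, E w z x y]
    calc x ∧' y ∧' z ∧' w = (x ∧' y ∧' z ∧' w) ∧' (x ∧' y ∧' z ∧' w) := (meet_idem _).symm
      _ = (x ∧' y ∧' z ∧' w ∧' x) ∧' (y ∧' z ∧' w) := by simp only [meet_assoc]
      _ = (x ∧' z ∧' y ∧' w ∧' x) ∧' (y ∧' z ∧' w) := by rw [E1]
      _ = x ∧' z ∧' y ∧' (w ∧' x ∧' y ∧' z ∧' w) := by simp only [meet_assoc]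
      _ = x ∧' z ∧' y ∧' (w ∧' x ∧' z ∧' y ∧' w) := by rw [E2]
      _ = (x ∧' z ∧' y ∧' w) ∧' (x ∧' z ∧' y ∧' w) := by simp only [meet_assoc]
      _ = x ∧' z ∧' y ∧' w := meet_idem _

end SkewLattice
end
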